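/- arXiv:1607.06796 — 2 statements merged into one kernel-verified Lean document; each statement's English description precedes it below -/
import Mathlib

section
/- Well-definedness of the boundary-layer steady states (Lemma of Section 2): there exist δ ∈ (0,1) and L₀ > 0 such that: (i) for every M ∈ (1−δ, 1), F(s) > F(M) for all s ∈ [0, M) and T(M) := √2 ∫₀^M ds/√(F(s) − F(M)) is finite; (ii) T is continuous and strictly increasing on (1−δ, 1) and T(M) → +∞ as M → 1⁻; (iii) for every L > L₀ there is a unique M(L) ∈ (1−δ, 1) with T(M(L)) = L, and the function L ↦ M(L) is strictly increasing on (L₀, ∞) with M(L) → 1 as L → +∞. -/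
open MeasureTheory Filter

/-- The length `T(M) = √2 ∫₀^M ds/√(F(s) − F(M))` of the interval on which the
Dirichlet steady state with maximum `M` exists. -/
noncomputable def steadyStateLength (F : ℝ → ℝ) (M : ℝ) : ℝ :=
  Real.sqrt 2 * ∫ s in Set.Ioo (0 : ℝ) M, 1 / Real.sqrt (F s - F M)


lemma aux_cov (F f ψ : ℝ → ℝ) (r M : ℝ) (hrM : r < M)
    (hd : ∀ s, HasDerivAt F (f s) s)
    (hanti : StrictAntiOn F (Set.Icc r M))
    (hf : ∀ s ∈ Set.Ioo r M, f s < 0)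
    (hψ : ∀ s ∈ Set.Ioo r M, ψ (F s) = f s ^ 2)
    (hIntr : IntegrableOn (fun u => 2 / √(ψ (F M + u ^ 2))) (Set.Ioo 0 √(F r - F M))) :
    IntegrableOn (fun s => 1 / √(F s - F M)) (Set.Ioo r M) ∧
    ∫ s in Set.Ioo r M, 1 / √(F s - F M) =
      ∫ u in (0:ℝ)..√(F r - F M), 2 / √(ψ (F M + u ^ 2)) := by
  have hFc : Continuous F := continuous_iff_continuousAt.2 fun s => (hd s).continuousAt
  have hpos : ∀ s ∈ Set.Ioo r M, 0 < F s - F M := fun s hs =>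
    sub_pos.2 (hanti ⟨hs.1.le, hs.2.le⟩ ⟨hrM.le, le_rfl⟩ hs.2)
  set U : ℝ → ℝ := fun s => √(F s - F M) with hU
  have hUd : ∀ s ∈ Set.Ioo r M, HasDerivWithinAt U (f s / (2 * √(F s - F M))) (Set.Ioo r M) s := by
    intro s hs
    exact (((hd s).sub_const (F M)).sqrt (hpos s hs).ne').hasDerivWithinAt
  have hUanti : StrictAntiOn U (Set.Icc r M) := by
    intro x hx y hy hxy
    apply Real.sqrt_lt_sqrt
    · have := hanti.antitoneOn hy ⟨hrM.le, le_rfl⟩ hy.2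
      linarith
    · have := hanti hx hy hxy
      linarith
  have hinj : Set.InjOn U (Set.Ioo r M) := hUanti.injOn.mono Set.Ioo_subset_Icc_self
  have hUM : U M = 0 := by simp [hU]
  have himg : U '' Set.Ioo r M = Set.Ioo 0 √(F r - F M) := by
    apply Set.Subset.antisymm
    · rintro _ ⟨s, hs, rfl⟩
      refine ⟨Real.sqrt_pos.2 (hpos s hs), ?_⟩
      exact hUanti ⟨le_rfl, hrM.le⟩ ⟨hs.1.le, hs.2.le⟩ hs.1
    · have := intermediate_value_Ioo' hrM.le (f := U)
        ((hFc.sub continuous_const).sqrt.continuousOn)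
      rwa [hUM] at this
  have hcongr : ∀ s ∈ Set.Ioo r M, |f s / (2 * √(F s - F M))| • (2 / √(ψ (F M + U s ^ 2)))
      = 1 / √(F s - F M) := by
    intro s hs
    have e : F M + U s ^ 2 = F s := by
      simp only [hU]; rw [Real.sq_sqrt (hpos s hs).le]; ring
    have h0 := Real.sqrt_pos.2 (hpos s hs)
    have h1 := hf s hs
    rw [e, hψ s hs, Real.sqrt_sq_eq_abs, abs_div, abs_of_pos (by positivity : 0 < 2 * √(F s - F M)),
      smul_eq_mul]
    have h2 : 0 < |f s| := abs_pos.2 h1.ne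
    field_simp
  have key1 := integral_image_eq_integral_abs_deriv_smul measurableSet_Ioo hUd hinj
    (fun u => 2 / √(ψ (F M + u ^ 2)))
  have key2 := integrableOn_image_iff_integrableOn_abs_deriv_smul measurableSet_Ioo hUd hinj
    (fun u => 2 / √(ψ (F M + u ^ 2)))
  rw [himg] at key1 key2
  rw [intervalIntegral.integral_of_le (Real.sqrt_nonneg _), integral_Ioc_eq_integral_Ioo, key1]
  refine ⟨(integrableOn_congr_fun hcongr measurableSet_Ioo).1 (key2.1 hIntr), ?_⟩
  exact (setIntegral_congr_fun measurableSet_Ioo hcongr).symm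

lemma aux_A (F : ℝ → ℝ) (hF : Continuous F) (r c : ℝ) (hr : 0 ≤ r) (hr1 : r ≤ 1) (hc : 0 < c)
    (hFc : ∀ s ∈ Set.Icc 0 r, 2 * c ≤ F s) :
    ContinuousOn (fun m => ∫ s in (0:ℝ)..r, 1 / √(F s - m)) (Set.Iic c) ∧
    ∀ m m', m ≤ m' → m' ≤ c → (∫ s in (0:ℝ)..r, 1 / √(F s - m')) -
      (∫ s in (0:ℝ)..r, 1 / √(F s - m)) ≤ (m' - m) / (c * √c) := by
  have hsc := Real.sqrt_pos.2 hc
  have hc1 : Continuous (fun m => ∫ s in (0:ℝ)..r, 1 / √(max (F s - m) c)) := by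
    apply intervalIntegral.continuous_parametric_intervalIntegral_of_continuous' (μ := volume)
    have : ∀ p : ℝ × ℝ, √(max (F p.2 - p.1) c) ≠ 0 := fun p =>
      (Real.sqrt_pos.2 (lt_max_of_lt_right hc)).ne'
    simp only [Function.uncurry_def]
    fun_prop (disch := exact this _)
  have hii : ∀ m ≤ c, IntervalIntegrable (fun s => 1 / √(F s - m)) volume 0 r := by
    intro m hm
    apply ContinuousOn.intervalIntegrable
    rw [Set.uIcc_of_le hr]
    apply ContinuousOn.div continuousOn_const (by fun_prop)
    intro s hs
    have := hFc s hs
    exact (Real.sqrt_pos.2 (by linarith)).ne'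
  refine ⟨hc1.continuousOn.congr ?_, ?_⟩
  · intro m hm
    apply intervalIntegral.integral_congr
    intro s hs
    rw [Set.uIcc_of_le hr] at hs
    have := hFc s hs
    have hm : m ≤ c := hm
    simp only
    rw [max_eq_left (by linarith)]
  · intro m m' hmm hm'
    rw [← intervalIntegral.integral_sub (hii _ hm') (hii _ (hmm.trans hm'))]
    calc _ ≤ ∫ s in (0:ℝ)..r, (m' - m) / (c * √c) := by
          apply intervalIntegral.integral_mono_on hr ((hii _ hm').sub (hii _ (hmm.trans hm')))
            (by simp)
          intro s hs
          have h1 := hFc s hs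
          have hp : √c ≤ √(F s - m') := Real.sqrt_le_sqrt (by linarith)
          have hq : √(F s - m') ≤ √(F s - m) := Real.sqrt_le_sqrt (by linarith)
          have ep := Real.sq_sqrt (show 0 ≤ F s - m' by linarith)
          have eq := Real.sq_sqrt (show 0 ≤ F s - m by linarith)
          have ec := Real.sq_sqrt hc.le
          generalize √(F s - m') = p at *
          generalize √(F s - m) = q at *
          generalize √c = k at *
          have hp0 : 0 < p := by linarith
          have hq0 : 0 < q := by linarith
          have e1 : 1 / p - 1 / q = (m' - m) / (p * q * (p + q)) := by
            have : m' - m = (q - p) * (q + p) := by linarith [eq, ep]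
            rw [this]; field_simp
            ring
          rw [e1]
          apply div_le_div_of_nonneg_left (by linarith) (by positivity)
          rw [← ec, sq]
          have : k * k ≤ p * q := by gcongr; linarith
          have h2 : k ≤ p + q := by linarith
          gcongr
      _ ≤ _ := by
          rw [intervalIntegral.integral_const, smul_eq_mul]
          have : 0 ≤ (m' - m) / (c * √c) := by
            apply div_nonneg (by linarith) (by positivity)
          nlinarith

lemma aux_B (ψ : ℝ → ℝ) (W a b : ℝ) (hW : 0 < W) (ha : 0 < a) (hb : 0 < b)
    (h0 : ψ 0 = 0)
    (hl : ∀ w w', 0 ≤ w → w ≤ w' → w' ≤ W → 2 * a * (w' - w) ≤ ψ w' - ψ w)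
    (hu : ∀ w w', 0 ≤ w → w ≤ w' → w' ≤ W → ψ w' - ψ w ≤ 2 * b * (w' - w)) :
    (∀ m ∈ Set.Ioo 0 W, ∀ R ≤ √(W - m),
      IntegrableOn (fun u => 2 / √(ψ (m + u ^ 2))) (Set.Ioo 0 R)) ∧
    ContinuousOn (fun m => ∫ u in (0:ℝ)..√(W - m), 2 / √(ψ (m + u ^ 2))) (Set.Ioo 0 W) ∧
    ∀ m m', 0 < m → m < m' → 2 * m' ≤ W → a * (m' - m) / (4 * b * √b * m') ≤
      (∫ u in (0:ℝ)..√(W - m), 2 / √(ψ (m + u ^ 2))) -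
      (∫ u in (0:ℝ)..√(W - m'), 2 / √(ψ (m' + u ^ 2))) := by
  have hψc : ContinuousOn ψ (Set.Icc 0 W) := by
    have : LipschitzOnWith (Real.toNNReal (2 * b)) ψ (Set.Icc 0 W) := by
      apply LipschitzOnWith.of_dist_le_mul
      have key : ∀ x ∈ Set.Icc 0 W, ∀ y ∈ Set.Icc 0 W, x ≤ y →
          dist (ψ x) (ψ y) ≤ (Real.toNNReal (2 * b)) * dist x y := by
        intro x hx y hy hxy
        rw [Real.coe_toNNReal _ (by positivity), dist_comm, dist_comm x, Real.dist_eq, Real.dist_eq,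
          abs_of_nonneg (by linarith : 0 ≤ y - x), abs_of_nonneg]
        · exact hu x y hx.1 hxy hy.2
        · have := hl x y hx.1 hxy hy.2
          have h3 : 0 ≤ 2 * a * (y - x) := mul_nonneg (by positivity) (by linarith)
          linarith
      intro x hx y hy
      rcases le_total x y with h | h
      · exact key x hx y hy h
      · rw [dist_comm, dist_comm x]; exact key y hy x hx h
    exact this.continuousOn
  have hlow : ∀ w, 0 ≤ w → w ≤ W → 2 * a * w ≤ ψ w := by
    intro w h h'
    have := hl 0 w le_rfl h h'
    rw [h0] at this; linarith
  have hup : ∀ w, 0 ≤ w → w ≤ W → ψ w ≤ 2 * b * w := by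
    intro w h h'
    have := hu 0 w le_rfl h h'
    rw [h0] at this; linarith
  have husq : ∀ m, m ≤ W → ∀ u, 0 ≤ u → u ≤ √(W - m) → m + u ^ 2 ≤ W := by
    intro m hm u hu0 hu
    have := (Real.le_sqrt hu0 (by linarith)).1 hu
    linarith
  have hcont : ∀ m ∈ Set.Ioo 0 W,
      ContinuousOn (fun u => 2 / √(ψ (m + u ^ 2))) (Set.Icc 0 √(W - m)) := by
    intro m hm
    have hmem : ∀ u ∈ Set.Icc 0 √(W - m), m + u ^ 2 ∈ Set.Icc 0 W := fun u hu =>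
      ⟨by have := hm.1; positivity, husq m hm.2.le u hu.1 hu.2⟩
    apply ContinuousOn.div continuousOn_const
    · exact (hψc.comp (by fun_prop) hmem).sqrt
    · intro u hu
      have h1 := hlow _ (hmem u hu).1 (hmem u hu).2
      have h2 : 0 < 2 * a * (m + u ^ 2) := by have := hm.1; positivity
      exact (Real.sqrt_pos.2 (by linarith)).ne'
  refine ⟨?_, ?_, ?_⟩
  · intro m hm R hR
    exact ((hcont m hm).integrableOn_Icc).mono_set
      (Set.Ioo_subset_Icc_self.trans (Set.Icc_subset_Icc_right hR))
  · intro m0 hm0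
    apply ContinuousAt.continuousWithinAt
    set χ : ℝ → ℝ := Set.IccExtend hW.le (Set.domRestrict (Set.Icc 0 W) ψ) with hχ
    have hχc : Continuous χ := (continuousOn_iff_continuous_domRestrict.1 hψc).Icc_extend'
    have hk : 0 < a * m0 := mul_pos ha hm0.1
    have hc1 : Continuous (fun m => ∫ u in (0:ℝ)..√(W - m),
        2 / √(max (χ (m + u ^ 2)) (a * m0))) := by
      apply intervalIntegral.continuous_parametric_intervalIntegral_of_continuous (μ := volume)
      · have : ∀ p : ℝ × ℝ, √(max (χ (p.1 + p.2 ^ 2)) (a * m0)) ≠ 0 := fun p =>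
          (Real.sqrt_pos.2 (lt_max_of_lt_right hk)).ne'
        simp only [Function.uncurry_def]
        fun_prop (disch := exact this _)
      · fun_prop
    refine hc1.continuousAt.congr ?_
    have : Set.Ioo (m0 / 2) W ∈ nhds m0 := Ioo_mem_nhds (by linarith [hm0.1]) hm0.2
    filter_upwards [this] with m hm
    apply intervalIntegral.integral_congr
    intro u hu
    rw [Set.uIcc_of_le (Real.sqrt_nonneg _)] at hu
    have hmem : m + u ^ 2 ∈ Set.Icc 0 W :=
      ⟨by have := hm.1; have := hm0.1; nlinarith [sq_nonneg u], husq m hm.2.le u hu.1 hu.2⟩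
    simp only
    rw [hχ, Set.IccExtend_of_mem _ _ hmem, Set.domRestrict_apply, max_eq_left]
    have := hlow _ hmem.1 hmem.2
    have h5 : m0 / 2 ≤ m + u ^ 2 := by nlinarith [sq_nonneg u, hm.1]
    simp only
    nlinarith
  · intro m m' hm hmm hm'
    have hm'0 : 0 < m' := hm.trans hmm
    have hM : m ∈ Set.Ioo 0 W := ⟨hm, by linarith⟩
    have hM' : m' ∈ Set.Ioo 0 W := ⟨hm'0, by linarith⟩
    have hss : √(W - m') ≤ √(W - m) := Real.sqrt_le_sqrt (by linarith)
    have hs1 : √m' ≤ √(W - m') := Real.sqrt_le_sqrt (by linarith)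
    have I : ∀ x ∈ Set.Ioo 0 W, ∀ p q, 0 ≤ p → p ≤ q → q ≤ √(W - x) →
        IntervalIntegrable (fun u => 2 / √(ψ (x + u ^ 2))) volume p q := by
      intro x hx p q hp hpq hq
      apply ContinuousOn.intervalIntegrable
      rw [Set.uIcc_of_le hpq]
      exact (hcont x hx).mono (Set.Icc_subset_Icc hp hq)
    have s0 := Real.sqrt_nonneg m'
    have s1 := Real.sqrt_nonneg (W - m')
    rw [← intervalIntegral.integral_add_adjacent_intervals
        (I m hM 0 (√(W - m')) le_rfl s1 hss)
        (I m hM _ (√(W - m)) s1 hss le_rfl),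
      ← intervalIntegral.integral_add_adjacent_intervals
        (I m hM 0 (√m') le_rfl s0 (hs1.trans hss))
        (I m hM _ (√(W - m')) s0 hs1 hss),
      ← intervalIntegral.integral_add_adjacent_intervals
        (I m' hM' 0 (√m') le_rfl s0 hs1)
        (I m' hM' _ (√(W - m')) s0 hs1 le_rfl)]
    have t1 : 0 ≤ ∫ u in √(W - m')..√(W - m), 2 / √(ψ (m + u ^ 2)) :=
      intervalIntegral.integral_nonneg hss fun u _ => by positivity
    have hbasic : ∀ u, 0 ≤ u → u ≤ √(W - m') → 0 < ψ (m + u ^ 2) ∧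
        2 * a * (m' - m) ≤ ψ (m' + u ^ 2) - ψ (m + u ^ 2) := by
      intro u hu0 hu
      have h6 := husq m' hM'.2.le u hu0 hu
      have h7 := hlow (m + u ^ 2) (by positivity) (by linarith)
      have h8 : 0 < 2 * a * (m + u ^ 2) := by positivity
      have h9 := hl (m + u ^ 2) (m' + u ^ 2) (by positivity) (by linarith) h6
      refine ⟨by linarith, ?_⟩
      calc _ = 2 * a * (m' + u ^ 2 - (m + u ^ 2)) := by ring
        _ ≤ _ := h9
    have t2 : (∫ u in √m'..√(W - m'), 2 / √(ψ (m' + u ^ 2))) ≤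
        ∫ u in √m'..√(W - m'), 2 / √(ψ (m + u ^ 2)) := by
      apply intervalIntegral.integral_mono_on hs1 (I m' hM' _ _ s0 hs1 le_rfl)
        (I m hM _ _ s0 hs1 hss)
      intro u hu
      obtain ⟨h6, h7⟩ := hbasic u (s0.trans hu.1) hu.2
      have h8 : 0 ≤ 2 * a * (m' - m) := mul_nonneg (by positivity) (by linarith)
      apply div_le_div_of_nonneg_left (by norm_num) (Real.sqrt_pos.2 h6)
      exact Real.sqrt_le_sqrt (by linarith)
    have t3 : a * (m' - m) / (4 * b * √b * m') ≤
        (∫ u in (0:ℝ)..√m', 2 / √(ψ (m + u ^ 2))) - ∫ u in (0:ℝ)..√m', 2 / √(ψ (m' + u ^ 2)) := by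
      rw [← intervalIntegral.integral_sub (I m hM _ _ le_rfl s0 (hs1.trans hss))
        (I m' hM' _ _ le_rfl s0 hs1)]
      have hsb := Real.sqrt_pos.2 hb
      have hsm := Real.sqrt_pos.2 hm'0
      have eb := Real.sq_sqrt hb.le
      have em := Real.sq_sqrt hm'0.le
      calc a * (m' - m) / (4 * b * √b * m')
          = ∫ u in (0:ℝ)..√m', 2 * (a * (m' - m) / (2 * √b * √m') ^ 3) := by
            rw [intervalIntegral.integral_const, smul_eq_mul]
            have e1 : (2 * √b * √m') ^ 3 = 8 * b * √b * (m' * √m') := by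
              calc _ = 8 * (√b ^ 2) * √b * ((√m') ^ 2 * √m') := by ring
                _ = _ := by rw [eb, em]
            rw [e1]
            field_simp
            ring
        _ ≤ _ := by
            apply intervalIntegral.integral_mono_on s0 (by simp)
              ((I m hM _ _ le_rfl s0 (hs1.trans hss)).sub (I m' hM' _ _ le_rfl s0 hs1))
            intro u hu
            obtain ⟨h6, h7⟩ := hbasic u hu.1 (hu.2.trans hs1)
            have h8 : 0 < 2 * a * (m' - m) := mul_pos (by positivity) (by linarith)
            have h9 := husq m' hM'.2.le u hu.1 (hu.2.trans hs1)
            have h10 := hup (m' + u ^ 2) (by positivity) h9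
            have h11 : u ^ 2 ≤ m' := by
              rw [← em]; exact pow_le_pow_left₀ hu.1 hu.2 2
            have h12 : √(ψ (m' + u ^ 2)) ≤ 2 * √b * √m' := by
              rw [Real.sqrt_le_left (by positivity)]
              calc _ ≤ 2 * b * (m' + u ^ 2) := h10
                _ ≤ 2 * b * (m' + m') := by gcongr
                _ = 4 * (√b ^ 2) * (√m' ^ 2) := by rw [eb, em]; ring
                _ = _ := by ring
            have hp := Real.sqrt_pos.2 h6
            have hq : √(ψ (m + u ^ 2)) ≤ √(ψ (m' + u ^ 2)) := Real.sqrt_le_sqrt (by linarith)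
            have ep := Real.sq_sqrt h6.le
            have eq := Real.sq_sqrt (show 0 ≤ ψ (m' + u ^ 2) by linarith)
            generalize √(ψ (m + u ^ 2)) = p at *
            generalize √(ψ (m' + u ^ 2)) = q at *
            generalize 2 * √b * √m' = k at *
            have hq0 : 0 < q := by linarith
            have hk0 : 0 < k := by linarith
            have e1 : 2 / p - 2 / q = 2 * ((q ^ 2 - p ^ 2) / (p * q * (p + q))) := by
              field_simp
              ring
            rw [e1]
            have h13 : p * q * (p + q) ≤ k * k * (k + k) := by
              have : p ≤ k := by linarith
              gcongr
            have h14 : 2 * a * (m' - m) ≤ q ^ 2 - p ^ 2 := by linarith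
            have : a * (m' - m) / k ^ 3 = (2 * a * (m' - m)) / (k * k * (k + k)) := by
              field_simp
              ring
            rw [this]
            have h15 : 0 < p * q * (p + q) := by positivity
            gcongr
            linarith
    linarith

lemma aux_local (F : ℝ → ℝ) (hF : ContDiff ℝ 2 F)
    (h1 : F 1 = 0) (h2 : deriv F 1 = 0) (h3 : 0 < deriv (deriv F) 1) :
    ∃ r a b : ℝ, 0 < r ∧ r < 1 ∧ 0 < a ∧ 0 < b ∧
      (∀ s, HasDerivAt F (deriv F s) s) ∧
      StrictAntiOn F (Set.Icc r 1) ∧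
      (∀ s ∈ Set.Ico r 1, deriv F s < 0) ∧
      (∀ s ∈ Set.Icc r 1, F s ≤ b * (1 - s) ^ 2) ∧
      ∃ ψ : ℝ → ℝ, ψ 0 = 0 ∧ (∀ s ∈ Set.Icc r 1, ψ (F s) = deriv F s ^ 2) ∧
        (∀ w w', 0 ≤ w → w ≤ w' → w' ≤ F r → 2 * a * (w' - w) ≤ ψ w' - ψ w) ∧
        (∀ w w', 0 ≤ w → w ≤ w' → w' ≤ F r → ψ w' - ψ w ≤ 2 * b * (w' - w)) := by
  have hd : ∀ s, HasDerivAt F (deriv F s) s := fun s =>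
    ((hF.differentiable (by norm_num)) s).hasDerivAt
  have hf1 : ContDiff ℝ 1 (deriv F) := by
    have : ContDiff ℝ (1 + 1) F := by norm_num; exact hF
    exact (contDiff_succ_iff_deriv.1 this).2.2
  have hd2 : ∀ s, HasDerivAt (deriv F) (deriv (deriv F) s) s := fun s =>
    ((hf1.differentiable (by norm_num)) s).hasDerivAt
  have hc2 : Continuous (deriv (deriv F)) := hf1.continuous_deriv (by norm_num)
  set f := deriv F with hf
  set κ := deriv f 1 with hκ
  have hnear : ∀ᶠ s in nhds (1:ℝ), deriv f s ∈ Set.Ioo (κ / 2) (2 * κ) :=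
    hc2.continuousAt.eventually (Ioo_mem_nhds (by linarith) (by linarith))
  obtain ⟨ε, hε, hball⟩ := Metric.eventually_nhds_iff.1 hnear
  set r := 1 - min (ε / 2) (1 / 2) with hr
  have hmin : 0 < min (ε / 2) (1 / 2 : ℝ) := by positivity
  have hmin2 : min (ε / 2) (1 / 2 : ℝ) ≤ 1 / 2 := min_le_right _ _
  have hmin3 : min (ε / 2) (1 / 2 : ℝ) ≤ ε / 2 := min_le_left _ _
  have hr0 : 0 < r := by linarith
  have hr1 : r < 1 := by linarith
  have hb : ∀ s ∈ Set.Icc r 1, deriv f s ∈ Set.Ioo (κ / 2) (2 * κ) := by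
    intro s hs
    apply hball
    rw [Real.dist_eq, abs_lt]
    constructor <;> linarith [hs.1, hs.2]
  have hFc : Continuous F := continuous_iff_continuousAt.2 fun s => (hd s).continuousAt
  have hfc : Continuous f := continuous_iff_continuousAt.2 fun s => (hd2 s).continuousAt
  have hconv : Convex ℝ (Set.Icc r (1:ℝ)) := convex_Icc r 1
  have hIntr : ∀ s ∈ interior (Set.Icc r (1:ℝ)), s ∈ Set.Icc r 1 := fun s hs => interior_subset hs
  have hfm : StrictMonoOn f (Set.Icc r 1) := by
    apply strictMonoOn_of_deriv_pos hconv hfc.continuousOn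
    intro s hs
    have := (hb s (hIntr s hs)).1
    linarith
  have h1mem : (1:ℝ) ∈ Set.Icc r 1 := ⟨hr1.le, le_rfl⟩
  have hfneg : ∀ s ∈ Set.Ico r 1, f s < 0 := by
    intro s hs
    have := hfm ⟨hs.1, hs.2.le⟩ h1mem hs.2
    rwa [h2] at this
  have hfle : ∀ s ∈ Set.Icc r 1, f s ≤ 0 := by
    intro s hs
    have := hfm.monotoneOn hs h1mem hs.2
    rwa [h2] at this
  have hFa : StrictAntiOn F (Set.Icc r 1) := by
    apply strictAntiOn_of_deriv_neg hconv hFc.continuousOn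
    intro s hs
    rw [interior_Icc] at hs
    exact hfneg s ⟨hs.1.le, hs.2⟩
  -- comparison functions
  have hG : ∀ c s, HasDerivAt (fun s => f s ^ 2 - 2 * c * F s) (2 * f s * (deriv f s - c)) s := by
    intro c s
    have := ((hd2 s).pow 2).sub ((hd s).const_mul (2 * c))
    refine HasDerivAt.congr_deriv (f := fun s => f s ^ 2 - 2 * c * F s) this ?_
    simp; ring
  have hGa : AntitoneOn (fun s => f s ^ 2 - 2 * (κ / 2) * F s) (Set.Icc r 1) := by
    apply antitoneOn_of_deriv_nonpos hconv
    · fun_prop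
    · exact fun s _ => (hG _ s).differentiableAt.differentiableWithinAt
    · intro s hs
      rw [(hG _ s).deriv]
      have := (hb s (hIntr s hs)).1
      have := hfle s (hIntr s hs)
      nlinarith
  have hGb : MonotoneOn (fun s => f s ^ 2 - 2 * (2 * κ) * F s) (Set.Icc r 1) := by
    apply monotoneOn_of_deriv_nonneg hconv
    · fun_prop
    · exact fun s _ => (hG _ s).differentiableAt.differentiableWithinAt
    · intro s hs
      rw [(hG _ s).deriv]
      have := (hb s (hIntr s hs)).2
      have := hfle s (hIntr s hs)
      nlinarith
  have hFq : ∀ s ∈ Set.Icc r 1, F s ≤ (2 * κ) * (1 - s) ^ 2 := by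
    -- f + 2κ(1-s) is antitone, hence nonnegative
    have e1 : AntitoneOn (fun s => f s + 2 * κ * (1 - s)) (Set.Icc r 1) := by
      have hh : ∀ s, HasDerivAt (fun s => f s + 2 * κ * (1 - s)) (deriv f s - 2 * κ) s := by
        intro s
        have := (hd2 s).add (((hasDerivAt_id s).const_sub 1).const_mul (2 * κ))
        refine HasDerivAt.congr_deriv (f := fun s => f s + 2 * κ * (1 - s)) this ?_
        ring
      apply antitoneOn_of_deriv_nonpos hconv
      · fun_prop
      · exact fun s _ => (hh s).differentiableAt.differentiableWithinAt
      · intro s hs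
        rw [(hh s).deriv]
        have := (hb s (hIntr s hs)).2
        linarith
    have e2 : MonotoneOn (fun s => F s - 2 * κ * (1 - s) ^ 2) (Set.Icc r 1) := by
      have hh : ∀ s, HasDerivAt (fun s => F s - 2 * κ * (1 - s) ^ 2)
          (f s + 4 * κ * (1 - s)) s := by
        intro s
        have := (hd s).sub ((((hasDerivAt_id s).const_sub 1).pow 2).const_mul (2 * κ))
        refine HasDerivAt.congr_deriv (f := fun s => F s - 2 * κ * (1 - s) ^ 2) this ?_
        simp; ring
      apply monotoneOn_of_deriv_nonneg hconv
      · fun_prop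
      · exact fun s _ => (hh s).differentiableAt.differentiableWithinAt
      · intro s hs
        rw [(hh s).deriv]
        have hs' := hIntr s hs
        have := e1 hs' h1mem hs'.2
        simp only [h2, sub_self, mul_zero, add_zero] at this
        have : 0 ≤ κ * (1 - s) := mul_nonneg h3.le (by linarith [hs'.2])
        linarith
    intro s hs
    have := e2 hs h1mem hs.2
    simp only [h1, sub_self] at this
    norm_num at this
    linarith
  refine ⟨r, κ / 2, 2 * κ, hr0, hr1, by linarith, by linarith, hd, hFa, hfneg, hFq, ?_⟩
  have hψF : ∀ s ∈ Set.Icc r 1, f (Function.invFunOn F (Set.Icc r 1) (F s)) ^ 2 = f s ^ 2 := by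
    intro s hs
    rw [hFa.injOn.leftInvOn_invFunOn hs]
  have hsurj : ∀ w, 0 ≤ w → w ≤ F r → ∃ s ∈ Set.Icc r 1, F s = w := by
    intro w h h'
    have := intermediate_value_Icc' hr1.le hFc.continuousOn
    exact this ⟨by rwa [h1], h'⟩
  refine ⟨fun w => f (Function.invFunOn F (Set.Icc r 1) w) ^ 2, ?_, hψF, ?_, ?_⟩
  · have := hψF 1 h1mem
    rw [h1] at this
    simp only [this, h2]; norm_num
  · intro w w' h h' h''
    obtain ⟨s, hs, rfl⟩ := hsurj w h (h'.trans h'')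
    obtain ⟨s', hs', rfl⟩ := hsurj w' (h.trans h') h''
    simp only [hψF s hs, hψF s' hs']
    have := hGa hs' hs ((hFa.le_iff_ge hs hs').1 h')
    simp only at this
    linarith
  · intro w w' h h' h''
    obtain ⟨s, hs, rfl⟩ := hsurj w h (h'.trans h'')
    obtain ⟨s', hs', rfl⟩ := hsurj w' (h.trans h') h''
    simp only [hψF s hs, hψF s' hs']
    have := hGb hs' hs ((hFa.le_iff_ge hs hs').1 h')
    simp only at this
    linarith

lemma aux_inv (T : ℝ → ℝ) (x : ℝ) (hx : x < 1) (hc : ContinuousOn T (Set.Ioo x 1))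
    (hm : StrictMonoOn T (Set.Ioo x 1)) (ht : Tendsto T (nhdsWithin 1 (Set.Iio 1)) atTop) :
    ∃ L₀ : ℝ, 0 < L₀ ∧ ∃ Mf : ℝ → ℝ,
        (∀ L : ℝ, L₀ < L →
          Mf L ∈ Set.Ioo x 1 ∧ T (Mf L) = L ∧
          ∀ M' ∈ Set.Ioo x 1, T M' = L → M' = Mf L) ∧
        StrictMonoOn Mf (Set.Ioi L₀) ∧
        Tendsto Mf atTop (nhds 1) := by
  set y := (x + 1) / 2 with hy
  have hymem : y ∈ Set.Ioo x 1 := ⟨by linarith, by linarith⟩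
  have hex : ∀ L, max 1 (T y) < L → ∃ M ∈ Set.Ioo x 1, T M = L := by
    intro L hL
    have hL' : T y < L := (le_max_right _ _).trans_lt hL
    have e1 := ht.eventually_gt_atTop L
    have e2 : ∀ᶠ z in nhdsWithin (1:ℝ) (Set.Iio 1), z ∈ Set.Ioo y 1 :=
      Ioo_mem_nhdsLT hymem.2
    obtain ⟨z, hz, hz2⟩ := (e1.and e2).exists
    have := intermediate_value_Icc hz2.1.le
      (hc.mono (fun t ht => ⟨hymem.1.trans_le ht.1, ht.2.trans_lt hz2.2⟩))
    obtain ⟨M, hM, hTM⟩ := this ⟨hL'.le, le_of_lt hz⟩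
    exact ⟨M, ⟨hymem.1.trans_le hM.1, hM.2.trans_lt hz2.2⟩, hTM⟩
  choose! Mf hMf hT using hex
  refine ⟨max 1 (T y), by positivity, Mf, ?_, ?_, ?_⟩
  · intro L hL
    refine ⟨hMf L hL, hT L hL, fun M' hM' h => hm.injOn hM' (hMf L hL) ?_⟩
    rw [h, hT L hL]
  · intro L hL L' hL' hLL
    rw [← hm.lt_iff_lt (hMf L hL) (hMf L' hL'), hT L hL, hT L' hL']
    exact hLL
  · rw [tendsto_order]
    refine ⟨fun p hp => ?_, fun p hp => ?_⟩
    · have hz : max p y ∈ Set.Ioo x 1 := ⟨lt_max_of_lt_right hymem.1, max_lt hp hymem.2⟩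
      filter_upwards [eventually_gt_atTop (max 1 (T y)), eventually_gt_atTop (T (max p y))]
        with L hL hL2
      rw [← hT L hL, hm.lt_iff_lt hz (hMf L hL)] at hL2
      exact (le_max_left _ _).trans_lt hL2
    · filter_upwards [eventually_gt_atTop (max 1 (T y))] with L hL
      exact (hMf L hL).2.trans hp

theorem boundary_layer_steady_states_well_defined
    (F : ℝ → ℝ) (hF : ContDiff ℝ 2 F)
    (h1 : F 1 = 0) (h2 : deriv F 1 = 0) (h3 : 0 < deriv (deriv F) 1)
    (h4 : ∀ s ∈ Set.Ico (0 : ℝ) 1, 0 < F s) :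
    ∃ δ ∈ Set.Ioo (0 : ℝ) 1, ∃ L₀ : ℝ, 0 < L₀ ∧
      (∀ M ∈ Set.Ioo (1 - δ) 1,
        (∀ s ∈ Set.Ico (0 : ℝ) M, F M < F s) ∧
        IntegrableOn (fun s => 1 / Real.sqrt (F s - F M)) (Set.Ioo 0 M)) ∧
      (ContinuousOn (steadyStateLength F) (Set.Ioo (1 - δ) 1) ∧
        StrictMonoOn (steadyStateLength F) (Set.Ioo (1 - δ) 1) ∧
        Tendsto (steadyStateLength F) (nhdsWithin 1 (Set.Iio 1)) atTop) ∧
      (∃ Mf : ℝ → ℝ,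
        (∀ L : ℝ, L₀ < L →
          Mf L ∈ Set.Ioo (1 - δ) 1 ∧ steadyStateLength F (Mf L) = L ∧
          ∀ M' ∈ Set.Ioo (1 - δ) 1, steadyStateLength F M' = L → M' = Mf L) ∧
        StrictMonoOn Mf (Set.Ioi L₀) ∧
        Tendsto Mf atTop (nhds 1)) := by
  obtain ⟨r, a, b, hr0, hr1, ha, hb, hd, hFa, hfneg, hFq, ψ, hψ0, hψF, hψl, hψu⟩ :=
    aux_local F hF h1 h2 h3
  have hFc : Continuous F := hF.continuous
  have hFr : 0 < F r := h4 r ⟨hr0.le, hr1⟩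
  -- lower bound of F on [0,r]
  obtain ⟨c, hc, hFc2⟩ : ∃ c, 0 < c ∧ ∀ s ∈ Set.Icc 0 r, 2 * c ≤ F s := by
    obtain ⟨x, hx, hmin⟩ := isCompact_Icc.exists_isMinOn (Set.nonempty_Icc.2 hr0.le)
      (hFc.continuousOn (s := Set.Icc 0 r))
    refine ⟨F x / 2, half_pos (h4 x ⟨hx.1, hx.2.trans_lt hr1⟩), fun s hs => ?_⟩
    have : F x ≤ F s := hmin hs
    linarith
  have h2c : 2 * c ≤ F r := hFc2 r ⟨hr0.le, le_rfl⟩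
  obtain ⟨hAc, hAl⟩ := aux_A F hFc r c hr0.le hr1.le hc hFc2
  obtain ⟨hBi, hBc, hBl⟩ := aux_B ψ (F r) a b hFr ha hb hψ0 hψl hψu
  set A : ℝ → ℝ := fun m => ∫ s in (0:ℝ)..r, 1 / √(F s - m) with hA
  set B : ℝ → ℝ := fun m => ∫ u in (0:ℝ)..√(F r - m), 2 / √(ψ (m + u ^ 2)) with hB
  have hsb := Real.sqrt_pos.2 hb
  have hsc := Real.sqrt_pos.2 hc
  set m1 := min c (a * (c * √c) / (4 * b * √b)) with hm1
  have hm1pos : 0 < m1 := by positivity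
  have hm1c : m1 ≤ c := min_le_left _ _
  have hm1k : m1 ≤ a * (c * √c) / (4 * b * √b) := min_le_right _ _
  -- strict antitonicity in the energy
  have hAB : StrictAntiOn (fun m => A m + B m) (Set.Ioo 0 m1) := by
    intro m hm m' hm' hmm
    have e1 := hAl m m' hmm.le (hm'.2.le.trans hm1c)
    have e2 := hBl m m' hm.1 hmm (by linarith [hm'.2])
    have e3 : (m' - m) / (c * √c) < a * (m' - m) / (4 * b * √b * m') := by
      have hm'0 := hm'.1
      have e4 : m' < a * (c * √c) / (4 * b * √b) := hm'.2.trans_le hm1k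
      rw [lt_div_iff₀ (by positivity)] at e4
      rw [div_lt_div_iff₀ (by positivity) (by positivity)]
      have : 0 < m' - m := by linarith
      nlinarith
    show A m' + B m' < A m + B m
    linarith
  -- choice of δ
  obtain ⟨x, hxr, hx1, hxm⟩ : ∃ x, r ≤ x ∧ x < 1 ∧ ∀ M ∈ Set.Ioo x 1, F M < m1 := by
    have : ∀ᶠ s in nhds (1:ℝ), F s < m1 :=
      hFc.continuousAt.eventually_lt_const (by rw [h1]; exact hm1pos)
    obtain ⟨ε, hε, hball⟩ := Metric.eventually_nhds_iff.1 this
    refine ⟨max r (1 - ε), le_max_left _ _, max_lt hr1 (by linarith), fun M hM => hball ?_⟩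
    rw [Real.dist_eq, abs_lt]
    have := (le_max_right r (1 - ε)).trans_lt hM.1
    constructor <;> linarith [hM.2]
  have hFm : ∀ M ∈ Set.Ioo x 1, F M ∈ Set.Ioo 0 m1 := fun M hM =>
    ⟨h4 M ⟨(hr0.le.trans hxr).trans hM.1.le, hM.2⟩, hxm M hM⟩
  have hsub : Set.Ioo x 1 ⊆ Set.Icc r 1 := fun M hM => ⟨hxr.trans hM.1.le, hM.2.le⟩
  -- change of variables
  have hcov : ∀ M ∈ Set.Ioo x 1, IntegrableOn (fun s => 1 / √(F s - F M)) (Set.Ioo r M) ∧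
      ∫ s in Set.Ioo r M, 1 / √(F s - F M) = B (F M) := by
    intro M hM
    have hrM : r < M := hxr.trans_lt hM.1
    have hFM := hFm M hM
    apply aux_cov F (deriv F) ψ r M hrM hd (hFa.mono (Set.Icc_subset_Icc_right hM.2.le))
    · exact fun s hs => hfneg s ⟨hs.1.le, hs.2.trans hM.2⟩
    · exact fun s hs => hψF s ⟨hs.1.le, (hs.2.trans hM.2).le⟩
    · exact hBi (F M) ⟨hFM.1, by linarith [hFM.2]⟩ _ le_rfl
  have hIoc : ∀ M ∈ Set.Ioo x 1, IntegrableOn (fun s => 1 / √(F s - F M)) (Set.Ioc 0 r) := by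
    intro M hM
    have hFM := hFm M hM
    refine IntegrableOn.mono_set (t := Set.Icc 0 r) ?_ Set.Ioc_subset_Icc_self
    apply ContinuousOn.integrableOn_Icc
    apply ContinuousOn.div continuousOn_const (by fun_prop)
    intro s hs
    have := hFc2 s hs
    exact (Real.sqrt_pos.2 (by linarith [hFM.2])).ne'
  have hunion : ∀ M ∈ Set.Ioo x 1, Set.Ioc 0 r ∪ Set.Ioo r M = Set.Ioo 0 M := fun M hM =>
    Set.Ioc_union_Ioo_eq_Ioo hr0.le (hxr.trans_lt hM.1)
  have hintM : ∀ M ∈ Set.Ioo x 1, IntegrableOn (fun s => 1 / √(F s - F M)) (Set.Ioo 0 M) := by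
    intro M hM
    rw [← hunion M hM]
    exact (hIoc M hM).union (hcov M hM).1
  have hTeq : ∀ M ∈ Set.Ioo x 1, steadyStateLength F M = √2 * (A (F M) + B (F M)) := by
    intro M hM
    unfold steadyStateLength
    rw [← hunion M hM, setIntegral_union ?_ measurableSet_Ioo (hIoc M hM) (hcov M hM).1,
      (hcov M hM).2, hA]
    · simp only
      rw [intervalIntegral.integral_of_le hr0.le]
    · rw [Set.disjoint_left]
      intro s hs hs'
      exact absurd hs.2 (not_le.2 hs'.1)
  have hs2 : 0 < √(2:ℝ) := by positivity
  have hTc : ContinuousOn (steadyStateLength F) (Set.Ioo x 1) := by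
    refine ContinuousOn.congr ?_ hTeq
    apply ContinuousOn.mul continuousOn_const
    apply ContinuousOn.add
    · exact hAc.comp hFc.continuousOn fun M hM => (hFm M hM).2.le.trans hm1c
    · exact hBc.comp hFc.continuousOn fun M hM => ⟨(hFm M hM).1, by linarith [(hFm M hM).2]⟩
  have hTm : StrictMonoOn (steadyStateLength F) (Set.Ioo x 1) := by
    intro M hM M' hM' hMM
    rw [hTeq M hM, hTeq M' hM']
    apply mul_lt_mul_of_pos_left _ hs2
    exact hAB (hFm M' hM') (hFm M hM) (hFa (hsub hM) (hsub hM') hMM)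
  have hTt : Tendsto (steadyStateLength F) (nhdsWithin 1 (Set.Iio 1)) atTop := by
    have hlow : ∀ M ∈ Set.Ioo x 1,
        √2 * ((1 / √b) * (Real.log (1 - r) - Real.log (1 - M))) ≤ steadyStateLength F M := by
      intro M hM
      have hrM : r < M := hxr.trans_lt hM.1
      unfold steadyStateLength
      apply mul_le_mul_of_nonneg_left _ hs2.le
      have hcts : ContinuousOn (fun s => (1 / √b) * (1 / (1 - s))) (Set.Icc r M) := by
        apply ContinuousOn.mul continuousOn_const
        apply ContinuousOn.div continuousOn_const (by fun_prop)
        intro s hs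
        linarith [hs.2, hM.2]
      have step1 : (1 / √b) * (Real.log (1 - r) - Real.log (1 - M)) =
          ∫ s in Set.Ioo r M, (1 / √b) * (1 / (1 - s)) := by
        rw [← integral_Ioc_eq_integral_Ioo, ← intervalIntegral.integral_of_le hrM.le,
          intervalIntegral.integral_eq_sub_of_hasDerivAt
            (f := fun s => (1 / √b) * (- Real.log (1 - s)))]
        · ring
        · intro s hs
          rw [Set.uIcc_of_le hrM.le] at hs
          have hne : 1 - s ≠ 0 := by linarith [hs.2, hM.2]
          have := ((((hasDerivAt_id s).const_sub 1).log hne).neg).const_mul (1 / √b)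
          refine HasDerivAt.congr_deriv (f := fun s => (1 / √b) * (- Real.log (1 - s))) this ?_
          simp only [id]
          ring
        · apply ContinuousOn.intervalIntegrable
          rwa [Set.uIcc_of_le hrM.le]
      rw [step1]
      calc _ ≤ ∫ s in Set.Ioo r M, 1 / √(F s - F M) := by
            apply setIntegral_mono_on
              (hcts.integrableOn_Icc.mono_set Set.Ioo_subset_Icc_self) (hcov M hM).1
              measurableSet_Ioo
            intro s hs
            have hs1 : 0 < 1 - s := by linarith [hs.2, hM.2]
            have hsm : s ∈ Set.Icc r 1 := ⟨hs.1.le, by linarith⟩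
            have hlt := hFa hsm (hsub hM) hs.2
            have hq := hFq s hsm
            have hle : √(F s - F M) ≤ √b * (1 - s) := by
              rw [Real.sqrt_le_left (by positivity), mul_pow, Real.sq_sqrt hb.le]
              linarith [(hFm M hM).1]
            have hp : 0 < √(F s - F M) := Real.sqrt_pos.2 (by linarith)
            rw [one_div_mul_one_div]
            exact one_div_le_one_div_of_le hp hle
        _ ≤ _ := by
            apply setIntegral_mono_set (hintM M hM)
            · exact Eventually.of_forall fun s => by
                show 0 ≤ 1 / √(F s - F M)
                positivity
            · exact (Set.Ioo_subset_Ioo_left hr0.le).eventuallyLE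
    have hlog : Tendsto (fun M : ℝ => √2 * ((1 / √b) * (Real.log (1 - r) - Real.log (1 - M))))
        (nhdsWithin 1 (Set.Iio 1)) atTop := by
      apply Tendsto.const_mul_atTop hs2
      apply Tendsto.const_mul_atTop (by positivity)
      have e1 : Tendsto (fun M : ℝ => 1 - M) (nhdsWithin 1 (Set.Iio 1))
          (nhdsWithin 0 (Set.Ioi 0)) := by
        apply tendsto_nhdsWithin_of_tendsto_nhds_of_eventually_within
        · have : Tendsto (fun M : ℝ => 1 - M) (nhds 1) (nhds (1 - 1)) :=
            (continuous_const.sub continuous_id).tendsto 1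
          rw [sub_self] at this
          exact this.mono_left nhdsWithin_le_nhds
        · filter_upwards [self_mem_nhdsWithin] with M hM
          have : M < 1 := hM
          exact sub_pos.2 this
      have e2 := Real.tendsto_log_nhdsGT_zero.comp e1
      have e3 := tendsto_atTop_add_const_left (nhdsWithin (1:ℝ) (Set.Iio 1))
        (Real.log (1 - r)) (tendsto_neg_atBot_atTop.comp e2)
      refine e3.congr fun M => ?_
      simp [sub_eq_add_neg]
    refine tendsto_atTop_mono' _ ?_ hlog
    have : Set.Ioo x 1 ∈ nhdsWithin (1:ℝ) (Set.Iio 1) := Ioo_mem_nhdsLT hx1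
    filter_upwards [this] with M hM using hlow M hM
  obtain ⟨L₀, hL₀, hinv⟩ := aux_inv (steadyStateLength F) x hx1 hTc hTm hTt
  refine ⟨1 - x, ⟨by linarith, by linarith⟩, L₀, hL₀, ?_⟩
  rw [sub_sub_cancel]
  refine ⟨fun M hM => ⟨fun s hs => ?_, hintM M hM⟩, ⟨hTc, hTm, hTt⟩, hinv⟩
  rcases le_total s r with h | h
  · have := hFc2 s ⟨hs.1, h⟩
    linarith [(hFm M hM).2]
  · exact hFa ⟨h, hs.2.le.trans hM.2.le⟩ (hsub hM) hs.2
end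

section
/- Singular perturbation estimate (Theorem on the relaxation limit of the layer dynamics, Grönwall bound): under the stated hypotheses there exists a constant C > 0, depending only on N, C₀, T and c₀ (in particular independent of τ and γ), such that E_τ(t) ≤ C (E_τ(0) + 1 − γ + τ) for all t ∈ [0, T]. -/
open MeasureTheory

open Filter Topology in
theorem norm_slope_aux {E : Type*} [NormedAddCommGroup E] [NormedSpace ℝ E]
    (v : ℝ → E) (x k r : ℝ) (hk : 0 ≤ k) (g : E)
    (hv : HasDerivWithinAt v (g - k • v x) (Set.Ici x) x)
    (hr : ‖g‖ - k * ‖v x‖ < r) :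
    ∀ᶠ z in 𝓝[>] x, (z - x)⁻¹ * (‖v z‖ - ‖v x‖) < r := by
  have h1 := hasDerivWithinAt_iff_tendsto_slope.1 hv
  have hset : Set.Ici x \ {x} = Set.Ioi x := by ext y; simp [lt_iff_le_and_ne, eq_comm]
  rw [hset] at h1
  have h2 : Tendsto (fun z => ‖slope v x z + k • v x‖) (𝓝[>] x) (𝓝 ‖g‖) := by
    have := (h1.add_const (k • v x)).norm
    simpa using this
  have h3 := h2.eventually_lt_const (show ‖g‖ < r + k * ‖v x‖ by linarith)
  have h4 : ∀ᶠ z in 𝓝[>] x, k * (z - x) < 1 := by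
    have : Tendsto (fun z => k * (z - x)) (𝓝[>] x) (𝓝 (k * (x - x))) :=
      (Continuous.tendsto (by fun_prop) x).mono_left nhdsWithin_le_nhds
    exact this.eventually_lt_const (by simp)
  filter_upwards [h3, h4, self_mem_nhdsWithin] with z hz1 hz2 hz3
  have hs : 0 < z - x := sub_pos.2 hz3
  have e : v z = (1 - k * (z - x)) • v x + (z - x) • (slope v x z + k • v x) := by
    rw [smul_add, sub_smul_slope, vsub_eq_sub]
    module
  have n : ‖v z‖ ≤ (1 - k * (z - x)) * ‖v x‖ + (z - x) * ‖slope v x z + k • v x‖ := by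
    conv_lhs => rw [e]
    refine (norm_add_le _ _).trans ?_
    rw [norm_smul, norm_smul, Real.norm_of_nonneg hs.le, Real.norm_of_nonneg (by linarith)]
  rw [inv_mul_lt_iff₀ hs]
  nlinarith [mul_lt_mul_of_pos_left hz1 hs]

/-- Singular perturbation estimate (Grönwall bound) for the relaxation limit of
the layer dynamics: there is a constant `C > 0` depending only on `N`, `C₀`,
`T` and `c₀` (in particular independent of `τ`, `γ` and the solutions) such
that, for any data satisfying the hypotheses,
`E_τ(t) = γ|h(t) − h_p(t)| + τ|η(t) − η_p(t)| ≤ C (E_τ(0) + 1 − γ + τ)` on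
`[0, T]`, where `η_p = P ∘ h_p`. -/
theorem singular_perturbation_gronwall_bound
    (N : ℕ) (C₀ T c₀ : ℝ) (hC₀ : 0 < C₀) (hT : 0 < T) (hc₀ : 0 < c₀) :
    ∃ C : ℝ, 0 < C ∧
      ∀ (τ γ : ℝ), 0 < τ → c₀ ≤ γ → γ ≤ 1 →
      ∀ (P : EuclideanSpace ℝ (Fin N) → EuclideanSpace ℝ (Fin N)),
        ContDiff ℝ 1 P →
      ∀ (hp h η : ℝ → EuclideanSpace ℝ (Fin N)),
        (∀ t ∈ Set.Icc (0 : ℝ) T,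
          HasDerivWithinAt hp (P (hp t)) (Set.Icc 0 T) t) →
        (∀ t ∈ Set.Icc (0 : ℝ) T,
          HasDerivWithinAt h (η t) (Set.Icc 0 T) t) →
        (∀ t ∈ Set.Icc (0 : ℝ) T,
          HasDerivWithinAt η (τ⁻¹ • (P (h t) - γ • η t)) (Set.Icc 0 T) t) →
        (∀ t ∈ Set.Icc (0 : ℝ) T, ‖P (hp t)‖ ≤ C₀) →
        (∀ t ∈ Set.Icc (0 : ℝ) T, ‖fderiv ℝ P (hp t)‖ ≤ C₀) →
        (∀ t ∈ Set.Icc (0 : ℝ) T, ∀ d : EuclideanSpace ℝ (Fin N),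
          ‖P (hp t + d) - P (hp t)‖ ≤ C₀ * ‖d‖) →
        ∀ t ∈ Set.Icc (0 : ℝ) T,
          γ * ‖h t - hp t‖ + τ * ‖η t - P (hp t)‖ ≤
            C * ((γ * ‖h 0 - hp 0‖ + τ * ‖η 0 - P (hp 0)‖) + 1 - γ + τ) := by
  have hK : 0 < C₀ / c₀ := div_pos hC₀ hc₀
  refine ⟨Real.exp (C₀ / c₀ * T) * (1 + (C₀ + C₀ ^ 2) / (C₀ / c₀)), by positivity, ?_⟩
  intro τ γ hτ hγ hγ1 P hP hp h η dhp dh dη b1 b2 b3 t ht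
  have hγ0 : 0 < γ := hc₀.trans_le hγ
  have dP : ∀ t ∈ Set.Icc (0 : ℝ) T, HasDerivWithinAt (fun s => P (hp s))
      (fderiv ℝ P (hp t) (P (hp t))) (Set.Icc 0 T) t := fun t ht =>
    ((hP.differentiable (by norm_num)) (hp t)).hasFDerivAt.comp_hasDerivWithinAt t (dhp t ht)
  set G : ℝ → EuclideanSpace ℝ (Fin N) := fun t =>
    (P (h t) - P (hp t)) + (1 - γ) • P (hp t) - τ • fderiv ℝ P (hp t) (P (hp t)) with hG
  have du : ∀ t ∈ Set.Icc (0 : ℝ) T, HasDerivWithinAt (fun s => h s - hp s)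
      ((η t - P (hp t)) - (0 : ℝ) • (h t - hp t)) (Set.Icc 0 T) t := fun t ht => by
    refine ((dh t ht).sub (dhp t ht)).congr_deriv ?_
    module
  have dv : ∀ t ∈ Set.Icc (0 : ℝ) T, HasDerivWithinAt (fun s => η s - P (hp s))
      (τ⁻¹ • G t - (τ⁻¹ * γ) • (η t - P (hp t))) (Set.Icc 0 T) t := fun t ht => by
    refine ((dη t ht).sub (dP t ht)).congr_deriv ?_
    have : fderiv ℝ P (hp t) (P (hp t)) =
        τ⁻¹ • τ • fderiv ℝ P (hp t) (P (hp t)) := by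
      rw [smul_smul, inv_mul_cancel₀ hτ.ne', one_smul]
    simp only [hG]
    conv_lhs => rw [this]
    module
  have bG : ∀ t ∈ Set.Icc (0 : ℝ) T,
      ‖G t‖ ≤ C₀ * ‖h t - hp t‖ + ((1 - γ) * C₀ + τ * C₀ ^ 2) := fun t ht => by
    have e1 : ‖P (h t) - P (hp t)‖ ≤ C₀ * ‖h t - hp t‖ := by
      simpa using b3 t ht (h t - hp t)
    have e2 : ‖(1 - γ) • P (hp t)‖ ≤ (1 - γ) * C₀ := by
      rw [norm_smul, Real.norm_of_nonneg (by linarith)]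
      exact mul_le_mul_of_nonneg_left (b1 t ht) (by linarith)
    have e3 : ‖τ • fderiv ℝ P (hp t) (P (hp t))‖ ≤ τ * C₀ ^ 2 := by
      rw [norm_smul, Real.norm_of_nonneg hτ.le, sq]
      refine mul_le_mul_of_nonneg_left ?_ hτ.le
      exact (ContinuousLinearMap.le_opNorm _ _).trans
        (mul_le_mul (b2 t ht) (b1 t ht) (norm_nonneg _) hC₀.le)
    have := norm_sub_le ((P (h t) - P (hp t)) + (1 - γ) • P (hp t))
      (τ • fderiv ℝ P (hp t) (P (hp t)))
    have := norm_add_le (P (h t) - P (hp t)) ((1 - γ) • P (hp t))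
    simp only [hG]
    linarith
  have cu : ContinuousOn (fun s => h s - hp s) (Set.Icc 0 T) :=
    fun s hs => (du s hs).continuousWithinAt
  have cv : ContinuousOn (fun s => η s - P (hp s)) (Set.Icc 0 T) :=
    fun s hs => (dv s hs).continuousWithinAt
  have key := le_gronwallBound_of_liminf_deriv_right_le
    (f := fun t => γ * ‖h t - hp t‖ + τ * ‖η t - P (hp t)‖) (f' := fun t => ‖G t‖)
    (δ := γ * ‖h 0 - hp 0‖ + τ * ‖η 0 - P (hp 0)‖) (K := C₀ / c₀)
    (ε := (1 - γ) * C₀ + τ * C₀ ^ 2) (a := 0) (b := T)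
    ((continuousOn_const.mul cu.norm).add (continuousOn_const.mul cv.norm))
    (by
      intro x hx r hr
      have hxI : x ∈ Set.Icc (0 : ℝ) T := Set.Ico_subset_Icc_self hx
      have hmem : Set.Icc (0 : ℝ) T ∈ nhdsWithin x (Set.Ici x) := Icc_mem_nhdsGE_of_mem hx
      have hd : 0 < (r - ‖G x‖) / 2 := by linarith
      have a1 := norm_slope_aux (fun s => h s - hp s) x 0
        (‖η x - P (hp x)‖ + γ⁻¹ * ((r - ‖G x‖) / 2)) le_rfl _
        ((du x hxI).mono_of_mem_nhdsWithin hmem) (by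
          have : 0 < γ⁻¹ * ((r - ‖G x‖) / 2) := by positivity
          linarith)
      have a2 := norm_slope_aux (fun s => η s - P (hp s)) x (τ⁻¹ * γ)
        (τ⁻¹ * (‖G x‖ - γ * ‖η x - P (hp x)‖ + (r - ‖G x‖) / 2)) (by positivity) _
        ((dv x hxI).mono_of_mem_nhdsWithin hmem) (by
          have : 0 < τ⁻¹ * ((r - ‖G x‖) / 2) := by positivity
          rw [norm_smul, Real.norm_of_nonneg (by positivity : 0 ≤ τ⁻¹)]
          linarith)
      refine Filter.Eventually.frequently ?_
      filter_upwards [a1, a2] with z h1 h2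
      have h1' := mul_lt_mul_of_pos_left h1 hγ0
      have h2' := mul_lt_mul_of_pos_left h2 hτ
      rw [mul_add, mul_inv_cancel_left₀ hγ0.ne'] at h1'
      rw [mul_inv_cancel_left₀ hτ.ne'] at h2'
      linarith)
    le_rfl
    (by
      intro x hx
      have hb := bG x (Set.Ico_subset_Icc_self hx)
      have n1 := norm_nonneg (h x - hp x)
      have n2 : 0 ≤ C₀ / c₀ * (τ * ‖η x - P (hp x)‖) := by positivity
      have n3 : C₀ * ‖h x - hp x‖ ≤ C₀ / c₀ * (γ * ‖h x - hp x‖) := by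
        have : C₀ * ‖h x - hp x‖ = C₀ / c₀ * (c₀ * ‖h x - hp x‖) := by field_simp
        rw [this]
        gcongr
      linarith)
    t ht
  refine key.trans ?_
  rw [gronwallBound_of_K_ne_0 hK.ne', sub_zero]
  set δ := γ * ‖h 0 - hp 0‖ + τ * ‖η 0 - P (hp 0)‖ with hδ
  have hδ0 : 0 ≤ δ := by positivity
  set K := C₀ / c₀ with hKd
  have hexp : Real.exp (K * t) ≤ Real.exp (K * T) :=
    Real.exp_le_exp.2 (mul_le_mul_of_nonneg_left ht.2 hK.le)
  have hε : (1 - γ) * C₀ + τ * C₀ ^ 2 ≤ (C₀ + C₀ ^ 2) * (δ + 1 - γ + τ) := by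
    have q1 : 0 ≤ (1 - γ) * C₀ ^ 2 := mul_nonneg (by linarith) (by positivity)
    have q2 : 0 ≤ τ * C₀ := by positivity
    have q3 : 0 ≤ (C₀ + C₀ ^ 2) * δ := by positivity
    linarith
  have hε0 : 0 ≤ (1 - γ) * C₀ + τ * C₀ ^ 2 :=
    add_nonneg (mul_nonneg (by linarith) hC₀.le) (by positivity)
  calc δ * Real.exp (K * t) + ((1 - γ) * C₀ + τ * C₀ ^ 2) / K * (Real.exp (K * t) - 1)
      ≤ (δ + 1 - γ + τ) * Real.exp (K * T) +
        ((C₀ + C₀ ^ 2) * (δ + 1 - γ + τ)) / K * Real.exp (K * T) := by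
        apply add_le_add
        · exact mul_le_mul (by linarith) hexp (Real.exp_pos _).le (by linarith)
        · refine mul_le_mul (div_le_div_of_nonneg_right hε hK.le) (by linarith) ?_
            (div_nonneg (hε0.trans hε) hK.le)
          have : 1 ≤ Real.exp (K * t) := Real.one_le_exp (mul_nonneg hK.le ht.1)
          linarith
    _ = _ := by ring
end
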